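/- arXiv:2403.03802 — 4 statements merged into one kernel-verified Lean document; each statement's English description precedes it below -/
import Mathlib

section
/- Let X be a random variable with CDF F, and let 1 ≤ j ≤ m and 1 ≤ i ≤ n with i ≥ j. If F is ID (i.e. F^{-1} is concave on (0,1)) and i/(n+1) ≥ j/(m+1), then X_{i:n} ≥_icv X_{j:m}. -/
open MeasureTheory Set Filter

/-- Generalized inverse (quantile function) `F⁻¹(p) = inf {x | p ≤ F x}` of a CDF `F`. -/
noncomputable def qf (F : ℝ → ℝ) (p : ℝ) : ℝ := sInf {x | p ≤ F x}

/-- `F` is a cumulative distribution function: monotone, right-continuous, with limits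
`0` at `-∞` and `1` at `+∞`. -/
def IsCDF (F : ℝ → ℝ) : Prop :=
  Monotone F ∧ (∀ x, ContinuousWithinAt F (Set.Ici x) x) ∧
    Tendsto F atBot (nhds 0) ∧ Tendsto F atTop (nhds 1)

/-- The (real) Beta function `B(a,b) = ∫₀¹ t^(a-1) (1-t)^(b-1) dt`. -/
noncomputable def Bfun (a b : ℝ) : ℝ :=
  ∫ t in Set.Ioo (0:ℝ) 1, t ^ (a - 1) * (1 - t) ^ (b - 1)

/-- The Beta(i, n-i+1) distribution on `ℝ`, i.e. the law of the `i`-th order statistic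
`B_{i:n}` of an i.i.d. uniform sample of size `n`. -/
noncomputable def betaLaw (i n : ℕ) : Measure ℝ :=
  (volume.restrict (Set.Ioo (0:ℝ) 1)).withDensity fun t =>
    ENNReal.ofReal (t ^ ((i:ℝ) - 1) * (1 - t) ^ ((n:ℝ) - (i:ℝ)) / Bfun (i:ℝ) ((n:ℝ) - (i:ℝ) + 1))

/-- The law of the `i`-th order statistic `X_{i:n}` of an i.i.d. sample of size `n` from the
CDF `F`: the pushforward of the Beta(i, n-i+1) measure under the quantile function `F⁻¹`. -/
noncomputable def osLaw (F : ℝ → ℝ) (i n : ℕ) : Measure ℝ := (betaLaw i n).map (qf F)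

/-- The `k`-th harmonic number `H_k = ∑_{r=1}^k 1/r`. -/
noncomputable def harm (k : ℕ) : ℝ := ∑ r ∈ Finset.Icc 1 k, (1:ℝ) / r

/-- Increasing concave order: `icvLE μ ν` means a random variable with law `μ` dominates one
with law `ν` in the increasing concave order, i.e. `E u(X) ≥ E u(Y)` for every increasing
concave `u` for which both expectations exist. -/
def icvLE (μ ν : MeasureTheory.Measure ℝ) : Prop :=
  ∀ u : ℝ → ℝ, Monotone u → ConcaveOn ℝ Set.univ u →
    MeasureTheory.Integrable u μ → MeasureTheory.Integrable u ν →
      ∫ x, u x ∂ν ≤ ∫ x, u x ∂μ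

/-- Increasing convex order: `icxLE μ ν` means a random variable with law `μ` dominates one
with law `ν` in the increasing convex order, i.e. `E u(X) ≥ E u(Y)` for every increasing
convex `u` for which both expectations exist. -/
def icxLE (μ ν : MeasureTheory.Measure ℝ) : Prop :=
  ∀ u : ℝ → ℝ, Monotone u → ConvexOn ℝ Set.univ u →
    MeasureTheory.Integrable u μ → MeasureTheory.Integrable u ν →
      ∫ x, u x ∂ν ≤ ∫ x, u x ∂μ

/-- A star-shaped function on `[0,∞)`: nonnegative there, vanishing at `0`, with
`x ↦ φ x / x` increasing on `(0,∞)`. -/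
def StarShaped (φ : ℝ → ℝ) : Prop :=
  φ 0 = 0 ∧ (∀ x, 0 ≤ x → 0 ≤ φ x) ∧ MonotoneOn (fun x => φ x / x) (Set.Ioi 0)

/-- Star-shaped order: `ssLE μ ν` means a (nonnegative) random variable with law `μ`
dominates one with law `ν` in the star-shaped order, i.e. `E φ(X) ≥ E φ(Y)` for every
star-shaped `φ` for which both expectations exist. -/
def ssLE (μ ν : MeasureTheory.Measure ℝ) : Prop :=
  ∀ φ : ℝ → ℝ, StarShaped φ → MeasureTheory.Integrable φ μ → MeasureTheory.Integrable φ ν →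
    ∫ x, φ x ∂ν ≤ ∫ x, φ x ∂μ

/-! ### Sign patterns -/

lemma slope_sign (f : ℝ → ℝ) (hf : ConcaveOn ℝ (Set.Ioo (0:ℝ) 1) f) (p q : ℝ)
    (hp : p ∈ Set.Ioo (0:ℝ) 1) (hq : q ∈ Set.Ioo (0:ℝ) 1) (hpq : p < q) (α β : ℝ)
    (h1 : f p = α * p + β) (h2 : f q = α * q + β) (t : ℝ) (ht : t ∈ Set.Ioo (0:ℝ) 1) :
    (t < p → f t ≤ α * t + β) ∧ (p ≤ t → t ≤ q → α * t + β ≤ f t) ∧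
      (q < t → f t ≤ α * t + β) := by
  refine ⟨fun h => ?_, fun ha hb => ?_, fun h => ?_⟩
  · have := hf.slope_anti_adjacent ht hq h hpq
    rw [h1, h2] at this
    have e : (α * q + β - (α * p + β)) / (q - p) = α := by
      have : q - p ≠ 0 := by linarith
      field_simp; ring
    rw [e, le_div_iff₀ (by linarith)] at this
    linarith
  · have hd : 0 < q - p := by linarith
    have := hf.2 hp hq
      (show 0 ≤ (q - t) / (q - p) from div_nonneg (by linarith) hd.le)
      (show 0 ≤ (t - p) / (q - p) from div_nonneg (by linarith) hd.le)
      (by field_simp; ring)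
    simp only [smul_eq_mul] at this
    rw [h1, h2] at this
    have e1 : (q - t) / (q - p) * p + (t - p) / (q - p) * q = t := by
      field_simp; ring
    have e2 : (q - t) / (q - p) * (α * p + β) + (t - p) / (q - p) * (α * q + β) = α * t + β := by
      field_simp; ring
    rw [e1, e2] at this
    exact this
  · have := hf.slope_anti_adjacent hp ht hpq h
    rw [h1, h2] at this
    have e : (α * q + β - (α * p + β)) / (q - p) = α := by
      have : q - p ≠ 0 := by linarith
      field_simp; ring
    rw [e, div_le_iff₀ (by linarith)] at this
    linarith

lemma crossing_two (g : ℝ → ℝ) (hm : MonotoneOn g (Set.Ioo (0:ℝ) 1))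
    (hc : ConcaveOn ℝ (Set.Ioo (0:ℝ) 1) g) (k l : ℕ) (hk : 0 < k) (hl : 0 < l) (K : ℝ)
    (hK : 0 < K) :
    (∀ t ∈ Set.Ioo (0:ℝ) 1, t ^ k * (1 - t) ^ l - K ≤ 0) ∨
    ∃ α β : ℝ, 0 ≤ α ∧ ∀ t ∈ Set.Ioo (0:ℝ) 1,
      0 ≤ (g t - (α * t + β)) * (t ^ k * (1 - t) ^ l - K) := by
  by_cases H : ∀ t ∈ Set.Ioo (0:ℝ) 1, t ^ k * (1 - t) ^ l - K ≤ 0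
  · exact Or.inl H
  right
  push Not at H
  obtain ⟨s, hs, hsK⟩ := H
  have hcont : Continuous (fun t : ℝ => t ^ k * (1 - t) ^ l) := by fun_prop
  obtain ⟨p, hp, hpK⟩ := intermediate_value_Ioo hs.1.le hcont.continuousOn
    (show K ∈ _ from ⟨by simp [hk.ne', hK], by simpa using hsK⟩)
  obtain ⟨q, hq, hqK⟩ := intermediate_value_Ioo' hs.2.le hcont.continuousOn
    (show K ∈ _ from ⟨by simp [hl.ne', hK], by simpa using hsK⟩)
  simp only at hpK hqK
  have hp' : p ∈ Set.Ioo (0:ℝ) 1 := ⟨hp.1, hp.2.trans hs.2⟩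
  have hq' : q ∈ Set.Ioo (0:ℝ) 1 := ⟨hs.1.trans hq.1, hq.2⟩
  have hpq : p < q := hp.2.trans hq.1
  let L : ℝ → ℝ := fun t => (k:ℝ) * Real.log t + (l:ℝ) * Real.log (1 - t)
  have hL : ConcaveOn ℝ (Set.Ioo (0:ℝ) 1) L := by
    have c1 : ConcaveOn ℝ (Set.Ioo (0:ℝ) 1) Real.log :=
      strictConcaveOn_log_Ioi.concaveOn.subset (fun x hx => hx.1) (convex_Ioo 0 1)
    have c2 : ConcaveOn ℝ (Set.Ioo (0:ℝ) 1) (fun t => Real.log (1 - t)) := by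
      refine ⟨convex_Ioo 0 1, fun x hx y hy a b ha hb hab => ?_⟩
      have := strictConcaveOn_log_Ioi.concaveOn.2 (x := 1 - x) (y := 1 - y)
        (by simpa using hx.2) (by simpa using hy.2) ha hb hab
      have e : a • (1 - x) + b • (1 - y) = 1 - (a • x + b • y) := by
        simp only [smul_eq_mul]; linear_combination hab
      rw [e] at this
      exact this
    exact (c1.smul (Nat.cast_nonneg k)).add (c2.smul (Nat.cast_nonneg l))
  have hLe : ∀ t ∈ Set.Ioo (0:ℝ) 1, L t = Real.log (t ^ k * (1 - t) ^ l) := by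
    intro t ht
    have h1 : t ≠ 0 := ht.1.ne'
    have h2 : 1 - t ≠ 0 := by linarith [ht.2]
    rw [Real.log_mul (pow_ne_zero _ h1) (pow_ne_zero _ h2), Real.log_pow, Real.log_pow]
  have hLp : L p = 0 * p + Real.log K := by rw [hLe p hp', hpK]; ring
  have hLq : L q = 0 * q + Real.log K := by rw [hLe q hq', hqK]; ring
  set α := (g q - g p) / (q - p) with hα
  have hd : 0 < q - p := by linarith
  have hg1 : g p = α * p + (g p - α * p) := by ring
  have hg2 : g q = α * q + (g p - α * p) := by rw [hα]; field_simp; ring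
  refine ⟨α, g p - α * p, div_nonneg (by linarith [hm hp' hq' hpq.le]) hd.le, fun t ht => ?_⟩
  obtain ⟨a1, a2, a3⟩ := slope_sign g hc p q hp' hq' hpq _ _ hg1 hg2 t ht
  obtain ⟨b1, b2, b3⟩ := slope_sign L hL p q hp' hq' hpq _ _ hLp hLq t ht
  have hr : 0 < t ^ k * (1 - t) ^ l :=
    mul_pos (pow_pos ht.1 _) (pow_pos (by linarith [ht.2]) _)
  rw [hLe t ht, zero_mul, zero_add] at b1 b2 b3
  rw [Real.log_le_log_iff hr hK] at b1 b3
  rw [Real.log_le_log_iff hK hr] at b2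
  rcases lt_or_ge t p with h | h
  · exact mul_nonneg_of_nonpos_of_nonpos (by linarith [a1 h]) (by linarith [b1 h])
  rcases le_or_gt t q with h' | h'
  · exact mul_nonneg (by linarith [a2 h h']) (by linarith [b2 h h'])
  · exact mul_nonneg_of_nonpos_of_nonpos (by linarith [a3 h']) (by linarith [b3 h'])

lemma crossing_one (g : ℝ → ℝ) (hm : MonotoneOn g (Set.Ioo (0:ℝ) 1)) (D : ℝ → ℝ)
    (hD : ContinuousOn D (Set.Ioo (0:ℝ) 1)) (hDm : MonotoneOn D (Set.Ioo (0:ℝ) 1)) :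
    (∀ t ∈ Set.Ioo (0:ℝ) 1, D t ≤ 0) ∨ (∀ t ∈ Set.Ioo (0:ℝ) 1, 0 ≤ D t) ∨
    ∃ α β : ℝ, 0 ≤ α ∧ ∀ t ∈ Set.Ioo (0:ℝ) 1, 0 ≤ (g t - (α * t + β)) * D t := by
  by_cases H : ∀ t ∈ Set.Ioo (0:ℝ) 1, D t ≤ 0
  · exact Or.inl H
  by_cases H' : ∀ t ∈ Set.Ioo (0:ℝ) 1, 0 ≤ D t
  · exact Or.inr (Or.inl H')
  right; right
  push Not at H H'
  obtain ⟨s, hs, hs0⟩ := H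
  obtain ⟨r, hr, hr0⟩ := H'
  obtain ⟨p, hp, hp0⟩ := isPreconnected_Ioo.intermediate_value hr hs hD
    (show (0:ℝ) ∈ _ from ⟨hr0.le, hs0.le⟩)
  refine ⟨0, g p, le_rfl, fun t ht => ?_⟩
  rcases le_total t p with h | h
  · exact mul_nonneg_of_nonpos_of_nonpos (by linarith [hm ht hp h]) (by linarith [hDm ht hp h])
  · exact mul_nonneg (by linarith [hm hp ht h]) (by linarith [hDm hp ht h])

/-! ### Beta integrals with natural exponents -/

/-- Beta integral with natural exponents. -/
noncomputable def bI (a b : ℕ) : ℝ := ∫ t in Set.Ioo (0:ℝ) 1, t ^ a * (1 - t) ^ b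

lemma bI_int {f : ℝ → ℝ} (hf : Continuous f) : IntegrableOn f (Set.Ioo (0:ℝ) 1) :=
  (hf.integrableOn_Icc (a := 0) (b := 1)).mono_set Set.Ioo_subset_Icc_self

lemma bI_pos (a b : ℕ) : 0 < bI a b := by
  unfold bI
  rw [← integral_Ioc_eq_integral_Ioo, ← intervalIntegral.integral_of_le zero_le_one]
  refine intervalIntegral.intervalIntegral_pos_of_pos_on
    (Continuous.intervalIntegrable (by fun_prop) _ _) (fun x hx => ?_) zero_lt_one
  exact mul_pos (pow_pos hx.1 _) (pow_pos (by linarith [hx.2]) _)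

lemma bI_rec (a b : ℕ) : bI (a + 1) b = ((a:ℝ) + 1) / ((a:ℝ) + b + 2) * bI a b := by
  have h1 : bI a (b + 1) = bI a b - bI (a + 1) b := by
    unfold bI
    rw [← integral_sub (bI_int (by fun_prop)) (bI_int (by fun_prop))]
    congr 1; ext t; ring
  have h2 : ((a:ℝ) + 1) * bI a (b + 1) - ((b:ℝ) + 1) * bI (a + 1) b = 0 := by
    unfold bI
    rw [← integral_const_mul, ← integral_const_mul,
      ← integral_sub (bI_int (by fun_prop)) (bI_int (by fun_prop)),
      ← integral_Ioc_eq_integral_Ioo, ← intervalIntegral.integral_of_le zero_le_one]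
    rw [intervalIntegral.integral_eq_sub_of_hasDerivAt
      (f := fun t : ℝ => t ^ (a + 1) * (1 - t) ^ (b + 1))]
    · simp
    · intro x _
      have d1 := hasDerivAt_pow (a + 1) x
      have d2 := ((hasDerivAt_id x).const_sub 1).pow (b + 1)
      refine (d1.mul d2).congr_deriv ?_
      simp only [Nat.add_sub_cancel, id, Pi.pow_apply]
      push_cast
      ring
    · exact Continuous.intervalIntegrable (by fun_prop) _ _
  have h3 : (a:ℝ) + b + 2 ≠ 0 := by positivity
  field_simp
  rw [h1] at h2
  linarith

/-- The normalised beta density. -/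
noncomputable def wd (a b : ℕ) (t : ℝ) : ℝ := t ^ a * (1 - t) ^ b / bI a b

lemma wd_cont (a b : ℕ) : Continuous (wd a b) := by unfold wd; fun_prop

lemma wd_one (a b : ℕ) : ∫ t in Set.Ioo (0:ℝ) 1, wd a b t = 1 := by
  unfold wd
  rw [integral_div]
  exact div_self (bI_pos a b).ne'

lemma wd_mean (a b : ℕ) :
    ∫ t in Set.Ioo (0:ℝ) 1, t * wd a b t = ((a:ℝ) + 1) / ((a:ℝ) + b + 2) := by
  have : ∀ t, t * wd a b t = t ^ (a + 1) * (1 - t) ^ b / bI a b := by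
    intro t; unfold wd; ring
  simp_rw [this]
  rw [integral_div]
  change bI (a + 1) b / bI a b = _
  rw [bI_rec]
  exact mul_div_cancel_right₀ _ (bI_pos a b).ne'

lemma core (a b c d : ℕ) (g : ℝ → ℝ) (hm : MonotoneOn g (Set.Ioo (0:ℝ) 1))
    (hc : ConcaveOn ℝ (Set.Ioo (0:ℝ) 1) g) (hca : c ≤ a)
    (hcond : ((c:ℝ) + 1) / ((c:ℝ) + d + 2) ≤ ((a:ℝ) + 1) / ((a:ℝ) + b + 2))
    (i1 : IntegrableOn (fun t => wd a b t * g t) (Set.Ioo (0:ℝ) 1))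
    (i2 : IntegrableOn (fun t => wd c d t * g t) (Set.Ioo (0:ℝ) 1)) :
    ∫ t in Set.Ioo (0:ℝ) 1, wd c d t * g t ≤ ∫ t in Set.Ioo (0:ℝ) 1, wd a b t * g t := by
  set h : ℝ → ℝ := fun t => wd a b t - wd c d t with hh
  have hcont : Continuous h := (wd_cont a b).sub (wd_cont c d)
  have h0 : ∫ t in Set.Ioo (0:ℝ) 1, h t = 0 := by
    rw [integral_sub (bI_int (wd_cont a b)) (bI_int (wd_cont c d)), wd_one, wd_one, sub_self]
  have h1 : 0 ≤ ∫ t in Set.Ioo (0:ℝ) 1, t * h t := by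
    simp only [hh, mul_sub]
    have w1 := wd_cont a b
    have w2 := wd_cont c d
    rw [integral_sub (bI_int (by fun_prop)) (bI_int (by fun_prop)), wd_mean, wd_mean]
    linarith
  have hgi : IntegrableOn (fun t => h t * g t) (Set.Ioo (0:ℝ) 1) := by
    simp only [hh, sub_mul]; exact i1.sub i2
  suffices hs : 0 ≤ ∫ t in Set.Ioo (0:ℝ) 1, h t * g t by
    simp only [hh, sub_mul] at hs
    rw [integral_sub i1 i2] at hs
    linarith
  -- factor the difference of the densities
  have hA := bI_pos a b
  have hC := bI_pos c d
  have hK : 0 < bI a b / bI c d := div_pos hA hC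
  obtain ⟨P, D, hP, hfac, hD⟩ : ∃ P D : ℝ → ℝ, (∀ t ∈ Set.Ioo (0:ℝ) 1, 0 < P t) ∧
      (∀ t, h t = P t * D t) ∧ ((∀ t ∈ Set.Ioo (0:ℝ) 1, D t ≤ 0) ∨
        (∀ t ∈ Set.Ioo (0:ℝ) 1, 0 ≤ D t) ∨
        ∃ α β : ℝ, 0 ≤ α ∧ ∀ t ∈ Set.Ioo (0:ℝ) 1, 0 ≤ (g t - (α * t + β)) * D t) := by
    obtain ⟨k, rfl⟩ := Nat.exists_eq_add_of_le hca
    rcases Nat.lt_or_ge d b with hdb | hbd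
    · obtain ⟨l, rfl⟩ := Nat.exists_eq_add_of_le hdb.le
      have hl : 0 < l := by omega
      have hk : 0 < k := by
        rcases Nat.eq_zero_or_pos k with rfl | hk
        · exfalso
          rw [div_le_div_iff₀ (by positivity) (by positivity)] at hcond
          push_cast at hcond
          have hl' : (0:ℝ) < l := by exact_mod_cast hl
          nlinarith [mul_pos (show (0:ℝ) < (c:ℝ) + 1 by positivity) hl']
        · exact hk
      refine ⟨fun t => t ^ c * (1 - t) ^ d / bI (c + k) (d + l),
        fun t => t ^ k * (1 - t) ^ l - bI (c + k) (d + l) / bI c d, fun t ht => ?_,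
        fun t => ?_, ?_⟩
      · exact div_pos (mul_pos (pow_pos ht.1 _) (pow_pos (by linarith [ht.2]) _)) hA
      · simp only [hh, wd]
        field_simp
        ring
      · rcases crossing_two g hm hc k l hk hl _ hK with H | H
        · exact Or.inl H
        · exact Or.inr (Or.inr H)
    · obtain ⟨l, rfl⟩ := Nat.exists_eq_add_of_le hbd
      refine ⟨fun t => t ^ c * (1 - t) ^ b / bI (c + k) b,
        fun t => t ^ k - bI (c + k) b / bI c (b + l) * (1 - t) ^ l, fun t ht => ?_,
        fun t => ?_, ?_⟩
      · exact div_pos (mul_pos (pow_pos ht.1 _) (pow_pos (by linarith [ht.2]) _)) hA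
      · simp only [hh, wd]
        field_simp
        ring
      · refine crossing_one g hm _ (by fun_prop) (fun x hx y hy hxy => ?_)
        have e1 : x ^ k ≤ y ^ k := pow_le_pow_left₀ hx.1.le hxy k
        have e2 : (1 - y) ^ l ≤ (1 - x) ^ l :=
          pow_le_pow_left₀ (by linarith [hy.2]) (by linarith) l
        have e3 := mul_le_mul_of_nonneg_left e2 hK.le
        linarith
  have hzero : (h =ᵐ[volume.restrict (Set.Ioo (0:ℝ) 1)] 0) →
      0 ≤ ∫ t in Set.Ioo (0:ℝ) 1, h t * g t := by
    intro hz
    have : (fun t => h t * g t) =ᵐ[volume.restrict (Set.Ioo (0:ℝ) 1)] fun _ => (0:ℝ) := by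
      filter_upwards [hz] with t ht
      simp [ht]
    rw [integral_congr_ae this]; simp
  rcases hD with H | H | ⟨α, β, hα, H⟩
  · apply hzero
    have hn : 0 ≤ᵐ[volume.restrict (Set.Ioo (0:ℝ) 1)] fun t => - h t := by
      refine (ae_restrict_iff' measurableSet_Ioo).2 (Eventually.of_forall fun t ht => ?_)
      have := mul_nonpos_of_nonneg_of_nonpos (hP t ht).le (H t ht)
      simp only [Pi.zero_apply, hfac]; linarith
    have := (integral_eq_zero_iff_of_nonneg_ae hn (bI_int hcont).neg).1
      (by rw [integral_neg, h0, neg_zero])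
    filter_upwards [this] with t ht
    simpa using ht
  · apply hzero
    have hn : 0 ≤ᵐ[volume.restrict (Set.Ioo (0:ℝ) 1)] h := by
      refine (ae_restrict_iff' measurableSet_Ioo).2 (Eventually.of_forall fun t ht => ?_)
      simp only [Pi.zero_apply, hfac]
      exact mul_nonneg (hP t ht).le (H t ht)
    exact (integral_eq_zero_iff_of_nonneg_ae hn (bI_int hcont)).1 h0
  · have il : IntegrableOn (fun t => α * (t * h t) + β * h t) (Set.Ioo (0:ℝ) 1) :=
      bI_int (by fun_prop)
    have hle : ∫ t in Set.Ioo (0:ℝ) 1, (α * (t * h t) + β * h t) ≤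
        ∫ t in Set.Ioo (0:ℝ) 1, h t * g t := by
      refine setIntegral_mono_on il hgi measurableSet_Ioo fun t ht => ?_
      have := mul_nonneg (hP t ht).le (H t ht)
      rw [hfac]; nlinarith [this]
    rw [integral_add (bI_int (by fun_prop)) (bI_int (by fun_prop)), integral_const_mul,
      integral_const_mul, h0] at hle
    have := mul_nonneg hα h1
    linarith

/-! ### Reduction to the core inequality -/

lemma qf_mono (F : ℝ → ℝ) (hF : IsCDF F) : MonotoneOn (qf F) (Set.Ioo (0:ℝ) 1) := by
  intro p hp q hq hpq
  obtain ⟨hmono, _, hbot, htop⟩ := hF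
  unfold qf
  refine csInf_le_csInf ?_ ?_ (fun x hx => le_trans hpq hx)
  · obtain ⟨x, hx⟩ := (hbot.eventually (gt_mem_nhds hp.1)).exists
    refine ⟨x, fun y hy => ?_⟩
    by_contra hyx
    have h1 := hmono (not_le.1 hyx).le
    have h2 : p ≤ F y := hy
    linarith
  · obtain ⟨x, hx⟩ := (htop.eventually (lt_mem_nhds hq.2)).exists
    exact ⟨x, le_of_lt hx⟩

lemma density_eq (i n : ℕ) (hi : 1 ≤ i) (hin : i ≤ n) (t : ℝ) :
    t ^ ((i:ℝ) - 1) * (1 - t) ^ ((n:ℝ) - (i:ℝ)) / Bfun (i:ℝ) ((n:ℝ) - (i:ℝ) + 1)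
      = wd (i - 1) (n - i) t := by
  have e1 : (i:ℝ) - 1 = ((i - 1 : ℕ) : ℝ) := by push_cast [hi]; ring
  have e2 : (n:ℝ) - (i:ℝ) = ((n - i : ℕ) : ℝ) := by push_cast [hin]; ring
  unfold wd bI Bfun
  rw [add_sub_cancel_right, e1, e2]
  simp only [Real.rpow_natCast]

lemma os_reduce (F : ℝ → ℝ) (hF : IsCDF F) (i n : ℕ) (hi : 1 ≤ i) (hin : i ≤ n)
    (u : ℝ → ℝ) (hu : Monotone u) (hint : Integrable u (osLaw F i n)) :
    IntegrableOn (fun t => wd (i - 1) (n - i) t * u (qf F t)) (Set.Ioo (0:ℝ) 1) ∧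
    ∫ x, u x ∂(osLaw F i n) =
      ∫ t in Set.Ioo (0:ℝ) 1, wd (i - 1) (n - i) t * u (qf F t) := by
  have hb : betaLaw i n = (volume.restrict (Set.Ioo (0:ℝ) 1)).withDensity
      fun t => ENNReal.ofReal (wd (i - 1) (n - i) t) := by
    unfold betaLaw
    simp_rw [density_eq i n hi hin]
  have hq0 : AEMeasurable (qf F) (volume.restrict (Set.Ioo (0:ℝ) 1)) :=
    aemeasurable_restrict_of_monotoneOn measurableSet_Ioo (qf_mono F hF)
  have hq : AEMeasurable (qf F) (betaLaw i n) := by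
    rw [hb]; exact hq0.mono_ac (withDensity_absolutelyContinuous _ _)
  have hum : AEStronglyMeasurable u ((betaLaw i n).map (qf F)) :=
    hu.measurable.aestronglyMeasurable
  have hmeas : Measurable fun t => ENNReal.ofReal (wd (i - 1) (n - i) t) :=
    (wd_cont _ _).measurable.ennreal_ofReal
  have hfin : ∀ᵐ t ∂(volume.restrict (Set.Ioo (0:ℝ) 1)),
      ENNReal.ofReal (wd (i - 1) (n - i) t) < ⊤ :=
    Eventually.of_forall fun t => ENNReal.ofReal_lt_top
  have hpos : ∀ t ∈ Set.Ioo (0:ℝ) 1,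
      (ENNReal.ofReal (wd (i - 1) (n - i) t)).toReal = wd (i - 1) (n - i) t := by
    intro t ht
    refine ENNReal.toReal_ofReal ?_
    exact div_nonneg (mul_nonneg (pow_nonneg ht.1.le _) (pow_nonneg (by linarith [ht.2]) _))
      (bI_pos _ _).le
  have hI : Integrable (u ∘ qf F) (betaLaw i n) :=
    (integrable_map_measure hum hq).1 hint
  constructor
  · rw [hb, integrable_withDensity_iff_integrable_smul' hmeas hfin] at hI
    refine IntegrableOn.congr_fun hI (fun t ht => ?_) measurableSet_Ioo
    simp only [smul_eq_mul, Function.comp]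
    rw [hpos t ht]
  · unfold osLaw
    rw [integral_map hq hum, hb, integral_withDensity_eq_integral_toReal_smul hmeas hfin]
    refine setIntegral_congr_fun measurableSet_Ioo (fun t ht => ?_)
    simp only [smul_eq_mul]
    rw [hpos t ht]

/-- If `F` is ID (`F⁻¹` concave on `(0,1)`) and `i/(n+1) ≥ j/(m+1)` with
`i ≥ j`, then `X_{i:n} ≥_icv X_{j:m}`. -/
theorem stmt1 (F : ℝ → ℝ) (hF : IsCDF F)
    (i n j m : ℕ) (hj1 : 1 ≤ j) (hjm : j ≤ m) (hi1 : 1 ≤ i) (hin : i ≤ n) (hij : j ≤ i)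
    (hID : ConcaveOn ℝ (Set.Ioo (0:ℝ) 1) (qf F))
    (hcond : (j:ℝ) / ((m:ℝ) + 1) ≤ (i:ℝ) / ((n:ℝ) + 1)) :
    icvLE (osLaw F i n) (osLaw F j m) := by
  intro u hu huc h1 h2
  obtain ⟨a1, a2⟩ := os_reduce F hF i n hi1 hin u hu h1
  obtain ⟨b1, b2⟩ := os_reduce F hF j m hj1 hjm u hu h2
  rw [a2, b2]
  have hq := qf_mono F hF
  refine core (i - 1) (n - i) (j - 1) (m - j) (fun t => u (qf F t))
    (fun x hx y hy hxy => hu (hq hx hy hxy)) ?_ (by omega) ?_ a1 b1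
  · refine ⟨convex_Ioo 0 1, fun x hx y hy a b ha hb hab => ?_⟩
    exact le_trans (huc.2 (Set.mem_univ _) (Set.mem_univ _) ha hb hab)
      (hu (hID.2 hx hy ha hb hab))
  · push_cast [hi1, hj1, hin, hjm]
    have e1 : (j:ℝ) - 1 + ((m:ℝ) - j) + 2 = m + 1 := by ring
    have e2 : (i:ℝ) - 1 + ((n:ℝ) - i) + 2 = n + 1 := by ring
    rw [e1, e2, sub_add_cancel, sub_add_cancel]
    exact hcond
end

section
/- Let X be a random variable with CDF F, and let 1 ≤ i ≤ n and 1 ≤ j ≤ m with i ≤ j. If F is DRHR (i.e. x ↦ log F(x) is concave on {x : F(x) > 0}) and ∑_{k=i}^{n} 1/k ≤ ∑_{k=j}^{m} 1/k, then X_{i:n} ≥_icx X_{j:m}. -/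
open MeasureTheory Set Filter

lemma os_int_pow (a b : ℕ) :
    ∫ t in (0:ℝ)..1, t ^ a * (1 - t) ^ b = (a.factorial * b.factorial : ℝ) / (a + b + 1).factorial := by
  induction b generalizing a with
  | zero =>
    simp [integral_pow, Nat.factorial_succ]
    field_simp
  | succ b ih =>
    have h : ∀ t : ℝ, t ^ a * (1 - t) ^ (b + 1) = t ^ a * (1 - t) ^ b - t ^ (a + 1) * (1 - t) ^ b := by
      intro t; ring
    simp_rw [h]
    rw [intervalIntegral.integral_sub, ih, ih]
    · rw [show a + 1 + b + 1 = (a + b + 1) + 1 by ring, show a + (b + 1) + 1 = (a + b + 1) + 1 by ring]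
      rw [Nat.factorial_succ (a + b + 1), Nat.factorial_succ a, Nat.factorial_succ b]
      push_cast
      field_simp
      ring
    · exact Continuous.intervalIntegrable (by fun_prop) _ _
    · exact Continuous.intervalIntegrable (by fun_prop) _ _

lemma os_ii_log (a b : ℕ) :
    IntervalIntegrable (fun t : ℝ => t ^ a * (1 - t) ^ b * Real.log t) volume 0 1 := by
  have := (intervalIntegral.intervalIntegrable_log' (a := 0) (b := 1)).continuousOn_mul
    (f := Real.log) (g := fun t : ℝ => t ^ a * (1 - t) ^ b) (by fun_prop)
  exact this

lemma os_int_log_base (a : ℕ) :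
    ∫ t in (0:ℝ)..1, t ^ a * Real.log t = - (1 / ((a:ℝ) + 1) ^ 2) := by
  have h0 : IntervalIntegrable (fun t : ℝ => t ^ a * Real.log t) volume 0 1 := by
    simpa using os_ii_log a 0
  have := intervalIntegral.integral_eq_sub_of_hasDerivAt_of_le (a := (0:ℝ)) (b := 1)
    (f := fun t : ℝ => t ^ a * (t * Real.log t) / (a + 1) - t ^ (a + 1) / ((a:ℝ) + 1) ^ 2)
    (f' := fun t : ℝ => t ^ a * Real.log t) (by norm_num) ?_ ?_ h0
  · rw [this]; simp
  · have := Real.continuous_mul_log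
    exact Continuous.continuousOn (by fun_prop)
  · intro x hx
    have hx0 : x ≠ 0 := hx.1.ne'
    have h1 : HasDerivAt (fun t : ℝ => t ^ (a + 1) * Real.log t / (a + 1) - t ^ (a + 1) / ((a:ℝ) + 1) ^ 2)
        ((((a + 1 : ℕ) : ℝ) * x ^ a * Real.log x + x ^ (a + 1) * x⁻¹) / (a + 1)
          - (((a + 1 : ℕ) : ℝ) * x ^ a) / ((a:ℝ) + 1) ^ 2) x := by
      have hp : HasDerivAt (fun t : ℝ => t ^ (a + 1)) (((a + 1 : ℕ) : ℝ) * x ^ a) x := by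
        simpa using hasDerivAt_pow (a + 1) x
      exact ((hp.mul (Real.hasDerivAt_log hx0)).div_const _).sub (hp.div_const _)
    have e1 : (fun t : ℝ => t ^ a * (t * Real.log t) / (a + 1) - t ^ (a + 1) / ((a:ℝ) + 1) ^ 2) =
        (fun t : ℝ => t ^ (a + 1) * Real.log t / (a + 1) - t ^ (a + 1) / ((a:ℝ) + 1) ^ 2) := by
      funext t; ring
    have e2 : x ^ a * Real.log x =
        ((((a + 1 : ℕ) : ℝ) * x ^ a * Real.log x + x ^ (a + 1) * x⁻¹) / (a + 1)
          - (((a + 1 : ℕ) : ℝ) * x ^ a) / ((a:ℝ) + 1) ^ 2) := by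
      push_cast
      field_simp
      ring
    rw [e1, e2]
    exact h1

lemma os_int_log (a b : ℕ) :
    ∫ t in (0:ℝ)..1, t ^ a * (1 - t) ^ b * Real.log t =
      - ((a.factorial * b.factorial : ℝ) / (a + b + 1).factorial *
        ∑ l ∈ Finset.range (b + 1), (1:ℝ) / (a + 1 + l)) := by
  induction b generalizing a with
  | zero =>
    simp only [pow_zero, mul_one, os_int_log_base]
    simp [Nat.factorial_succ]
    field_simp
  | succ b ih =>
    have h : ∀ t : ℝ, t ^ a * (1 - t) ^ (b + 1) * Real.log t =
        t ^ a * (1 - t) ^ b * Real.log t - t ^ (a + 1) * (1 - t) ^ b * Real.log t := by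
      intro t; ring
    simp_rw [h]
    rw [intervalIntegral.integral_sub (os_ii_log _ _) (os_ii_log _ _), ih, ih]
    rw [show a + 1 + b + 1 = (a + b + 1) + 1 by ring, show a + (b + 1) + 1 = (a + b + 1) + 1 by ring]
    rw [Nat.factorial_succ (a + b + 1), Nat.factorial_succ a, Nat.factorial_succ b]
    rw [Finset.sum_range_succ' _ b, Finset.sum_range_succ _ b, Finset.sum_range_succ' _ (b+1),
      Finset.sum_range_succ _ b]
    have e : ∀ l : ℕ, (a:ℝ) + 1 + ((l + 1 : ℕ) : ℝ) = ((a + 1 : ℕ) : ℝ) + 1 + l := by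
      intro l; push_cast; ring
    simp_rw [e]
    generalize ∑ l ∈ Finset.range b, (1:ℝ) / (((a + 1 : ℕ) : ℝ) + 1 + l) = T
    push_cast
    have h2 : (a:ℝ) + 1 + 1 + b ≠ 0 := by positivity
    have h3 : (a:ℝ) + b + 1 + 1 ≠ 0 := by positivity
    field_simp
    ring

lemma os_sum (i n : ℕ) (hin : i ≤ n) :
    ∑ k ∈ Finset.Icc i n, (1:ℝ) / k = ∑ l ∈ Finset.range (n - i + 1), (1:ℝ) / (i + l) := by
  rw [← Finset.Ico_succ_right_eq_Icc, Finset.sum_Ico_eq_sum_range]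
  have : Order.succ n - i = n - i + 1 := by simp [Order.succ]; omega
  rw [this]; push_cast; rfl

lemma os_ac (i n j m : ℕ) (hi1 : 1 ≤ i) (hin : i ≤ n) (hjm : j ≤ m) (hij : i ≤ j)
    (hcond : ∑ k ∈ Finset.Icc i n, (1:ℝ) / k ≤ ∑ k ∈ Finset.Icc j m, (1:ℝ) / k) :
    n - i ≤ m - j ∧ (i < j → n - i < m - j) := by
  rw [os_sum i n hin, os_sum j m hjm] at hcond
  have hi : (0:ℝ) < i := by exact_mod_cast hi1
  have hij' : (i:ℝ) ≤ j := by exact_mod_cast hij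
  have hle : ∑ l ∈ Finset.range (m - j + 1), (1:ℝ) / (j + l) ≤
      ∑ l ∈ Finset.range (m - j + 1), (1:ℝ) / (i + l) := by
    apply Finset.sum_le_sum
    intro l _
    gcongr
  constructor
  · by_contra hlt
    push Not at hlt
    have : ∑ l ∈ Finset.range (m - j + 1), (1:ℝ) / (i + l) <
        ∑ l ∈ Finset.range (n - i + 1), (1:ℝ) / (i + l) := by
      apply Finset.sum_lt_sum_of_subset (i := m - j + 1)
      · intro x; simp; omega
      · simp; omega
      · simp
      · positivity
      · intros; positivity
    linarith
  · intro hlt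
    by_contra hge
    push Not at hge
    have hlt' : (i:ℝ) < j := by exact_mod_cast hlt
    have h1 : ∑ l ∈ Finset.range (m - j + 1), (1:ℝ) / (j + l) <
      ∑ l ∈ Finset.range (m - j + 1), (1:ℝ) / (i + l) := by
      apply Finset.sum_lt_sum_of_nonempty (by simp)
      intro l _
      gcongr
    have : ∑ l ∈ Finset.range (m - j + 1), (1:ℝ) / (i + l) ≤
        ∑ l ∈ Finset.range (n - i + 1), (1:ℝ) / (i + l) := by
      apply Finset.sum_le_sum_of_subset_of_nonneg
      · intro x; simp; omega
      · intros; positivity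
    linarith

lemma os_qf_le (F : ℝ → ℝ) (hF : IsCDF F) {p : ℝ} (hp : p ∈ Ioo (0:ℝ) 1) (x : ℝ) :
    qf F p ≤ x ↔ p ≤ F x := by
  obtain ⟨hmono, hrc, hbot, htop⟩ := hF
  have hne : {x | p ≤ F x}.Nonempty := by
    obtain ⟨y, hy⟩ := (htop.eventually (eventually_gt_nhds hp.2)).exists
    exact ⟨y, le_of_lt hy⟩
  have hbdd : BddBelow {x | p ≤ F x} := by
    obtain ⟨y, hy⟩ := (hbot.eventually (eventually_lt_nhds hp.1)).exists
    refine ⟨y, fun z hz => ?_⟩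
    by_contra hlt
    push Not at hlt
    have := hmono hlt.le
    have hz' : p ≤ F z := hz
    linarith
  constructor
  · intro h
    refine le_trans ?_ (hmono h)
    -- right-continuity at the infimum
    have hev : ∀ y ∈ Ioi (qf F p), p ≤ F y := by
      intro y hy
      obtain ⟨z, hz, hzy⟩ := exists_lt_of_csInf_lt hne hy
      exact le_trans hz (hmono hzy.le)
    have ht : Tendsto F (nhdsWithin (qf F p) (Ioi (qf F p))) (nhds (F (qf F p))) :=
      (hrc (qf F p)).mono_left (nhdsWithin_mono _ Ioi_subset_Ici_self)
    exact ge_of_tendsto ht (eventually_nhdsWithin_of_forall hev)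
  · intro h
    exact csInf_le hbdd h

lemma os_qf_mono (F : ℝ → ℝ) (hF : IsCDF F) : MonotoneOn (qf F) (Ioo (0:ℝ) 1) := by
  intro p hp q hq hpq
  rw [os_qf_le F hF hp]
  exact hpq.trans ((os_qf_le F hF hq _).1 le_rfl)

lemma os_exp_mem {y : ℝ} (hy : y ∈ Iio (0:ℝ)) : Real.exp y ∈ Ioo (0:ℝ) 1 :=
  ⟨Real.exp_pos y, by simpa using hy⟩

lemma os_conv (F : ℝ → ℝ) (hF : IsCDF F)
    (hD : ConcaveOn ℝ {x : ℝ | 0 < F x} (fun x => Real.log (F x)))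
    (u : ℝ → ℝ) (hu : Monotone u) (huc : ConvexOn ℝ univ u) :
    ConvexOn ℝ (Iio 0) (fun y => u (qf F (Real.exp y))) := by
  refine ⟨convex_Iio 0, ?_⟩
  intro y1 h1 y2 h2 a b ha hb hab
  have hy := convex_Iio (0:ℝ) h1 h2 ha hb hab
  have k1 := (os_qf_le F hF (os_exp_mem h1) _).1 le_rfl
  have k2 := (os_qf_le F hF (os_exp_mem h2) _).1 le_rfl
  have p1 : 0 < F (qf F (Real.exp y1)) := lt_of_lt_of_le (Real.exp_pos _) k1
  have p2 : 0 < F (qf F (Real.exp y2)) := lt_of_lt_of_le (Real.exp_pos _) k2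
  have p3 := hD.1 p1 p2 ha hb hab
  have c := hD.2 p1 p2 ha hb hab
  have l1 := (Real.le_log_iff_exp_le p1).2 k1
  have l2 := (Real.le_log_iff_exp_le p2).2 k2
  have key : qf F (Real.exp (a • y1 + b • y2)) ≤
      a • qf F (Real.exp y1) + b • qf F (Real.exp y2) := by
    rw [os_qf_le F hF (os_exp_mem hy), ← Real.le_log_iff_exp_le p3]
    refine le_trans ?_ c
    simp only [smul_eq_mul]
    gcongr
  exact (hu key).trans (huc.2 (mem_univ _) (mem_univ _) ha hb hab)

lemma os_mono (F : ℝ → ℝ) (hF : IsCDF F) (u : ℝ → ℝ) (hu : Monotone u) :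
    MonotoneOn (fun y => u (qf F (Real.exp y))) (Iio 0) := by
  intro x hx y hy hxy
  exact hu (os_qf_mono F hF (os_exp_mem hx) (os_exp_mem hy) (Real.exp_le_exp.2 hxy))

/-- the negativity region -/
def osS (K : ℝ) (a c : ℕ) : Set ℝ := {t | t ∈ Ioo (0:ℝ) 1 ∧ K < t ^ a * (1 - t) ^ c}

lemma osS_conv (K : ℝ) (hK : 0 < K) (a c : ℕ) : Convex ℝ (osS K a c) := by
  have hc : ConcaveOn ℝ (Ioo (0:ℝ) 1)
      (fun t => (a:ℝ) * Real.log t + (c:ℝ) * Real.log (1 - t)) := by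
    have h1 : ConcaveOn ℝ (Ioo (0:ℝ) 1) Real.log :=
      strictConcaveOn_log_Ioi.concaveOn.subset (fun x hx => hx.1) (convex_Ioo 0 1)
    have h2 : ConcaveOn ℝ (Ioo (0:ℝ) 1) (fun t => Real.log (1 - t)) := by
      refine ⟨convex_Ioo 0 1, ?_⟩
      intro x hx y hy p q hp hq hpq
      have hx' : (1 - x) ∈ Ioi (0:ℝ) := by simpa using hx.2
      have hy' : (1 - y) ∈ Ioi (0:ℝ) := by simpa using hy.2
      have := strictConcaveOn_log_Ioi.concaveOn.2 hx' hy' hp hq hpq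
      refine this.trans (le_of_eq ?_)
      congr 1
      simp only [smul_eq_mul]
      linear_combination hpq
    exact (h1.smul (Nat.cast_nonneg a)).add (h2.smul (Nat.cast_nonneg c))
  have := hc.convex_gt (Real.log K)
  suffices e : osS K a c = {x | x ∈ Ioo (0:ℝ) 1 ∧
      Real.log K < (a:ℝ) * Real.log x + (c:ℝ) * Real.log (1 - x)} by
    rw [e]; exact this
  ext t
  change (_ ∧ _) ↔ (_ ∧ _)
  refine and_congr_right fun ht => ?_
  have h1 : (0:ℝ) < t := ht.1
  have h2 : (0:ℝ) < 1 - t := by linarith [ht.2]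
  rw [← Real.log_lt_log_iff hK (by positivity), Real.log_mul (by positivity) (by positivity),
    Real.log_pow, Real.log_pow]

lemma os_line (φ : ℝ → ℝ) (hφ : ConvexOn ℝ (Iio 0) φ) (hm : MonotoneOn φ (Iio 0))
    (K : ℝ) (hK : 0 < K) (a c : ℕ) (hac : 0 < a → 0 < c) (hc : 0 < c)
    (hS : ¬ (osS K a c).Subsingleton) :
    ∃ α β : ℝ, 0 ≤ β ∧ ∀ t ∈ Ioo (0:ℝ) 1,
      0 ≤ (φ (Real.log t) - α - β * Real.log t) * (K - t ^ a * (1 - t) ^ c) := by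
  have hord := (osS_conv K hK a c).ordConnected
  obtain ⟨x, hx, y, hy, hne⟩ := Set.not_subsingleton_iff.1 hS
  set S := osS K a c with hSdef
  have hub : ∀ t ∈ S, t ≤ 1 - K := by
    rintro t ⟨ht, h⟩
    have h1 : t ^ a ≤ 1 := pow_le_one₀ ht.1.le ht.2.le
    have h2 : (1 - t) ^ c ≤ 1 - t :=
      pow_le_of_le_one (by linarith [ht.2]) (by linarith [ht.1]) hc.ne'
    have h3 : 0 ≤ (1 - t) ^ c := pow_nonneg (by linarith [ht.2]) _
    nlinarith
  have hba : BddAbove S := ⟨1 - K, hub⟩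
  have hbb : BddBelow S := ⟨0, fun t ht => ht.1.1.le⟩
  have hnon : S.Nonempty := ⟨x, hx⟩
  have h12 : sInf S < sSup S := by
    have := csInf_le hbb hx; have := csInf_le hbb hy
    have := le_csSup hba hx; have := le_csSup hba hy
    rcases lt_or_gt_of_ne hne with h | h <;> linarith
  have ht2 : sSup S < 1 := lt_of_le_of_lt (csSup_le hnon hub) (by linarith)
  have ht2p : 0 < sSup S := lt_of_lt_of_le hx.1.1 (le_csSup hba hx)
  have hlog : ∀ t ∈ Ioo (0:ℝ) 1, Real.log t ∈ Iio (0:ℝ) := fun t ht => Real.log_neg ht.1 ht.2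
  have hin : ∀ t, sInf S < t → t < sSup S → t ∈ S := by
    intro t h1 h2
    obtain ⟨p, hp, hpt⟩ := exists_lt_of_csInf_lt hnon h1
    obtain ⟨q, hq, htq⟩ := exists_lt_of_lt_csSup hnon h2
    exact hord.out hp hq ⟨hpt.le, htq.le⟩
  have hout : ∀ t ∈ Ioo (0:ℝ) 1, t ∉ S → 0 ≤ K - t ^ a * (1 - t) ^ c := by
    intro t ht h
    by_contra hlt
    exact h ⟨ht, by linarith⟩
  have hinn : ∀ t ∈ S, K - t ^ a * (1 - t) ^ c ≤ 0 := fun t ht => by linarith [ht.2]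
  rcases Nat.eq_zero_or_pos a with ha | ha
  · -- monotone case
    refine ⟨φ (Real.log (sSup S)), 0, le_rfl, ?_⟩
    intro t ht
    rcases le_or_gt (sSup S) t with h | h
    · rcases h.eq_or_lt with h | h
      · rw [← h]; simp
      apply mul_nonneg
      · have := hm (hlog _ ⟨ht2p, ht2⟩) (hlog _ ht) (Real.log_le_log ht2p h.le)
        linarith
      · exact hout t ht (fun hS => absurd (le_csSup hba hS) (not_le.2 h))
    · have htS : t ∈ S := by
        obtain ⟨q, hq, htq⟩ := exists_lt_of_lt_csSup hnon h
        refine ⟨ht, lt_of_lt_of_le hq.2 ?_⟩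
        have : 0 ≤ 1 - q := by linarith [hq.1.2]
        subst ha
        simp only [pow_zero, one_mul]
        gcongr
      apply mul_nonneg_of_nonpos_of_nonpos _ (hinn t htS)
      have := hm (hlog _ ht) (hlog _ ⟨ht2p, ht2⟩) (Real.log_le_log ht.1 h.le)
      linarith
  · have hlb : ∀ t ∈ S, K ≤ t := by
      rintro t ⟨ht, h⟩
      have h1 : t ^ a ≤ t := pow_le_of_le_one ht.1.le ht.2.le ha.ne'
      have h2 : (1 - t) ^ c ≤ 1 := pow_le_one₀ (by linarith [ht.2]) (by linarith [ht.1])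
      have h3 : 0 ≤ t ^ a := pow_nonneg ht.1.le _
      nlinarith
    have ht1 : 0 < sInf S := lt_of_lt_of_le hK (le_csInf hnon hlb)
    set x1 := Real.log (sInf S) with hx1
    set x2 := Real.log (sSup S) with hx2
    have hx12 : x1 < x2 := Real.log_lt_log ht1 h12
    have m1 : x1 ∈ Iio (0:ℝ) := hlog _ ⟨ht1, h12.trans ht2⟩
    have m2 : x2 ∈ Iio (0:ℝ) := hlog _ ⟨ht2p, ht2⟩
    have hd : 0 < x2 - x1 := by linarith
    set β := (φ x2 - φ x1) / (x2 - x1) with hβ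
    have hβe : β * (x2 - x1) = φ x2 - φ x1 := by rw [hβ]; field_simp
    refine ⟨φ x1 - β * x1, β, div_nonneg (by linarith [hm m1 m2 hx12.le]) hd.le, ?_⟩
    intro t ht
    have mt := hlog t ht
    set z := Real.log t with hz
    rcases lt_trichotomy t (sInf S) with h | h | h
    · have hz1 : z < x1 := Real.log_lt_log ht.1 h
      apply mul_nonneg
      · have := hφ.slope_mono_adjacent mt m2 hz1 hx12
        rw [div_le_iff₀ (by linarith), ← hβ] at this
        linarith
      · exact hout t ht (fun hS => absurd (csInf_le hbb hS) (not_le.2 h))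
    · rw [hz, h]; simp [← hx1]
    rcases lt_trichotomy t (sSup S) with h' | h' | h'
    · have hz1 : x1 < z := Real.log_lt_log ht1 h
      have hz2 : z < x2 := Real.log_lt_log ht.1 h'
      apply mul_nonneg_of_nonpos_of_nonpos _ (hinn t (hin t h h'))
      have := hφ.secant_mono m1 mt m2 hz1.ne' hx12.ne' hz2.le
      rw [← hβ, div_le_iff₀ (by linarith)] at this
      linarith
    · have : φ z - (φ x1 - β * x1) - β * z = 0 := by
        rw [hz, h', ← hx2]; linarith
      rw [this]; simp
    · have hz2 : x2 < z := Real.log_lt_log ht2p h'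
      apply mul_nonneg
      · have := hφ.slope_mono_adjacent m1 mt hx12 hz2
        rw [← hβ, le_div_iff₀ (by linarith)] at this
        linarith
      · exact hout t ht (fun hS => absurd (le_csSup hba hS) (not_le.2 h'))

/-- normalising constant -/
noncomputable def osB (a b : ℕ) : ℝ := (a.factorial * b.factorial : ℝ) / (a + b + 1).factorial

lemma osB_pos (a b : ℕ) : 0 < osB a b := by unfold osB; positivity

/-- density with natural exponents -/
noncomputable def osf (a b : ℕ) (t : ℝ) : ℝ := t ^ a * (1 - t) ^ b / osB a b

lemma os_set_int (v : ℝ → ℝ) : ∫ t in Ioo (0:ℝ) 1, v t = ∫ t in (0:ℝ)..1, v t := by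
  rw [intervalIntegral.integral_of_le zero_le_one, integral_Ioc_eq_integral_Ioo]

lemma os_set_ii (v : ℝ → ℝ) (h : IntervalIntegrable v volume 0 1) :
    Integrable v (volume.restrict (Ioo (0:ℝ) 1)) :=
  ((intervalIntegrable_iff_integrableOn_Ioo_of_le zero_le_one).1 h)

lemma osf_int (a b : ℕ) : ∫ t in Ioo (0:ℝ) 1, osf a b t = 1 := by
  rw [os_set_int]
  unfold osf
  rw [intervalIntegral.integral_div, os_int_pow]
  exact div_self (osB_pos a b).ne'

lemma osf_integrable (a b : ℕ) : Integrable (osf a b) (volume.restrict (Ioo (0:ℝ) 1)) := by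
  apply os_set_ii
  unfold osf
  exact Continuous.intervalIntegrable (by fun_prop) _ _

lemma osf_log_int (a b : ℕ) : ∫ t in Ioo (0:ℝ) 1, osf a b t * Real.log t =
    - ∑ l ∈ Finset.range (b + 1), (1:ℝ) / (a + 1 + l) := by
  rw [os_set_int]
  have : ∀ t : ℝ, osf a b t * Real.log t = (t ^ a * (1 - t) ^ b * Real.log t) / osB a b := by
    intro t; unfold osf; ring
  simp_rw [this]
  rw [intervalIntegral.integral_div, os_int_log]
  have := (osB_pos a b).ne'
  change -(osB a b * _) / osB a b = _
  field_simp

lemma osf_log_integrable (a b : ℕ) :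
    Integrable (fun t => osf a b t * Real.log t) (volume.restrict (Ioo (0:ℝ) 1)) := by
  apply os_set_ii
  have : (fun t => osf a b t * Real.log t) =
      fun t => (t ^ a * (1 - t) ^ b * Real.log t) / osB a b := by
    funext t; unfold osf; ring
  rw [this]
  exact (os_ii_log a b).div_const _

lemma osf_nonneg (a b : ℕ) {t : ℝ} (ht : t ∈ Ioo (0:ℝ) 1) : 0 ≤ osf a b t := by
  have h1 : (0:ℝ) < t := ht.1
  have h2 : (0:ℝ) < 1 - t := by linarith [ht.2]
  have := osB_pos a b
  unfold osf
  positivity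

lemma os_betaLaw (i n : ℕ) (hi1 : 1 ≤ i) (hin : i ≤ n) :
    betaLaw i n = (volume.restrict (Ioo (0:ℝ) 1)).withDensity
      fun t => ENNReal.ofReal (osf (i - 1) (n - i) t) := by
  have e1 : (i:ℝ) - 1 = ((i - 1 : ℕ) : ℝ) := by push_cast [hi1]; ring
  have e2 : (n:ℝ) - i = ((n - i : ℕ) : ℝ) := by push_cast [hin]; ring
  have eB : Bfun (i:ℝ) ((n:ℝ) - (i:ℝ) + 1) = osB (i - 1) (n - i) := by
    unfold Bfun
    rw [add_sub_cancel_right, e1, e2]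
    simp_rw [Real.rpow_natCast]
    rw [os_set_int, os_int_pow]
    rfl
  unfold betaLaw
  rw [eB, e1, e2]
  simp_rw [Real.rpow_natCast]
  rfl

lemma osf_meas (a b : ℕ) : Measurable (osf a b) := by
  unfold osf
  exact Continuous.measurable (by fun_prop)

lemma os_beta_integrable (i n : ℕ) (hi1 : 1 ≤ i) (hin : i ≤ n) (v : ℝ → ℝ)
    (hv : Integrable v (betaLaw i n)) :
    Integrable (fun t => osf (i - 1) (n - i) t * v t) (volume.restrict (Ioo (0:ℝ) 1)) := by
  rw [os_betaLaw i n hi1 hin, integrable_withDensity_iff_integrable_smul'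
    (osf_meas _ _).ennreal_ofReal (by simp)] at hv
  refine hv.congr ?_
  filter_upwards [ae_restrict_mem measurableSet_Ioo] with t ht
  rw [ENNReal.toReal_ofReal (osf_nonneg _ _ ht), smul_eq_mul]

lemma os_beta_integral (i n : ℕ) (hi1 : 1 ≤ i) (hin : i ≤ n) (v : ℝ → ℝ) :
    ∫ t, v t ∂(betaLaw i n) = ∫ t in Ioo (0:ℝ) 1, osf (i - 1) (n - i) t * v t := by
  rw [os_betaLaw i n hi1 hin, integral_withDensity_eq_integral_toReal_smul
    (osf_meas _ _).ennreal_ofReal (by simp)]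
  apply setIntegral_congr_fun measurableSet_Ioo
  intro t ht
  simp only
  rw [ENNReal.toReal_ofReal (osf_nonneg _ _ ht), smul_eq_mul]

lemma os_qf_aem (F : ℝ → ℝ) (hF : IsCDF F) (i n : ℕ) : AEMeasurable (qf F) (betaLaw i n) := by
  have h : AEMeasurable (qf F) (volume.restrict (Ioo (0:ℝ) 1)) :=
    aemeasurable_restrict_of_monotoneOn measurableSet_Ioo (os_qf_mono F hF)
  exact h.mono_ac (withDensity_absolutelyContinuous _ _)

lemma os_diff (a b p q : ℕ) (t : ℝ) :
    osf a b t - osf (a + p) (b + q) t =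
      (t ^ a * (1 - t) ^ b / osB (a + p) (b + q)) *
        (osB (a + p) (b + q) / osB a b - t ^ p * (1 - t) ^ q) := by
  have h1 := (osB_pos a b).ne'
  have h2 := (osB_pos (a + p) (b + q)).ne'
  unfold osf
  field_simp
  ring

lemma os_core (φ w : ℝ → ℝ) (hφ : ConvexOn ℝ (Iio 0) φ) (hm : MonotoneOn φ (Iio 0))
    (hw : ∀ t ∈ Ioo (0:ℝ) 1, w t = φ (Real.log t))
    (a b p q : ℕ) (hpq : 0 < p → 0 < q)
    (hlog : ∫ t in Ioo (0:ℝ) 1, osf (a + p) (b + q) t * Real.log t ≤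
      ∫ t in Ioo (0:ℝ) 1, osf a b t * Real.log t)
    (hi1 : Integrable (fun t => osf a b t * w t) (volume.restrict (Ioo (0:ℝ) 1)))
    (hi2 : Integrable (fun t => osf (a + p) (b + q) t * w t) (volume.restrict (Ioo (0:ℝ) 1))) :
    ∫ t in Ioo (0:ℝ) 1, osf (a + p) (b + q) t * w t ≤
      ∫ t in Ioo (0:ℝ) 1, osf a b t * w t := by
  rcases Nat.eq_zero_or_pos q with hq | hq
  · have hp : p = 0 := by
      by_contra h
      have := hpq (Nat.pos_of_ne_zero h)
      omega
    subst hq hp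
    exact le_rfl
  set K := osB (a + p) (b + q) / osB a b with hKdef
  have hK : 0 < K := div_pos (osB_pos _ _) (osB_pos _ _)
  have hcoef : ∀ t ∈ Ioo (0:ℝ) 1, 0 ≤ t ^ a * (1 - t) ^ b / osB (a + p) (b + q) := by
    intro t ht
    have h1 : (0:ℝ) < t := ht.1
    have h2 : (0:ℝ) < 1 - t := by linarith [ht.2]
    have := osB_pos (a + p) (b + q)
    positivity
  by_cases hS : (osS K p q).Subsingleton
  · have hae : ∀ᵐ t ∂(volume.restrict (Ioo (0:ℝ) 1)), 0 ≤ osf a b t - osf (a + p) (b + q) t := by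
      have hnull : ∀ᵐ t ∂(volume.restrict (Ioo (0:ℝ) 1)), t ∉ osS K p q :=
        ae_restrict_of_ae (measure_eq_zero_iff_ae_notMem.1 (hS.measure_zero volume))
      filter_upwards [hnull, ae_restrict_mem measurableSet_Ioo] with t h1 ht
      rw [os_diff]
      apply mul_nonneg (hcoef t ht)
      by_contra hlt
      exact h1 ⟨ht, by linarith⟩
    have hz : ∫ t in Ioo (0:ℝ) 1, (osf a b t - osf (a + p) (b + q) t) = 0 := by
      rw [integral_sub (osf_integrable _ _) (osf_integrable _ _), osf_int, osf_int, sub_self]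
    rw [integral_eq_zero_iff_of_nonneg_ae hae
      ((osf_integrable _ _).sub (osf_integrable _ _))] at hz
    apply le_of_eq
    apply integral_congr_ae
    filter_upwards [hz] with t ht
    have : osf a b t - osf (a + p) (b + q) t = 0 := ht
    rw [sub_eq_zero.1 this]
  · obtain ⟨α, β, hβ, hpos⟩ := os_line φ hφ hm K hK p q hpq hq hS
    have hI := integral_nonneg_of_ae (μ := volume.restrict (Ioo (0:ℝ) 1))
      (f := fun t => (osf a b t * w t - osf (a + p) (b + q) t * w t)
        - (α * (osf a b t - osf (a + p) (b + q) t)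
          + β * (osf a b t * Real.log t - osf (a + p) (b + q) t * Real.log t))) (by
        filter_upwards [ae_restrict_mem measurableSet_Ioo] with t ht
        have h1 := mul_nonneg (hcoef t ht) (hpos t ht)
        have h2 := os_diff a b p q t
        rw [← hKdef] at h2
        rw [hw t ht]
        change 0 ≤ _
        refine h1.trans (le_of_eq ?_)
        linear_combination (-(φ (Real.log t) - α - β * Real.log t)) * h2)
    have g1 : Integrable (fun t => osf a b t - osf (a + p) (b + q) t)
        (volume.restrict (Ioo (0:ℝ) 1)) := (osf_integrable a b).sub (osf_integrable (a + p) (b + q))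
    have g2 : Integrable (fun t => osf a b t * Real.log t - osf (a + p) (b + q) t * Real.log t)
        (volume.restrict (Ioo (0:ℝ) 1)) :=
      (osf_log_integrable a b).sub (osf_log_integrable (a + p) (b + q))
    have g3 : Integrable (fun t => osf a b t * w t - osf (a + p) (b + q) t * w t)
        (volume.restrict (Ioo (0:ℝ) 1)) := hi1.sub hi2
    have g4 : Integrable (fun t => α * (osf a b t - osf (a + p) (b + q) t)
          + β * (osf a b t * Real.log t - osf (a + p) (b + q) t * Real.log t))
        (volume.restrict (Ioo (0:ℝ) 1)) := (g1.const_mul α).add (g2.const_mul β)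
    rw [integral_sub g3 g4,
      integral_sub hi1 hi2] at hI
    have e : ∫ t in Ioo (0:ℝ) 1, (α * (osf a b t - osf (a + p) (b + q) t)
          + β * (osf a b t * Real.log t - osf (a + p) (b + q) t * Real.log t)) =
        β * ((∫ t in Ioo (0:ℝ) 1, osf a b t * Real.log t)
          - ∫ t in Ioo (0:ℝ) 1, osf (a + p) (b + q) t * Real.log t) := by
      rw [integral_add (g1.const_mul α) (g2.const_mul β), integral_const_mul, integral_const_mul,
        integral_sub (osf_integrable _ _) (osf_integrable _ _), osf_int, osf_int,
        integral_sub (osf_log_integrable _ _) (osf_log_integrable _ _)]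
      ring
    have := mul_nonneg hβ (sub_nonneg.2 hlog)
    linarith

/-- If `F` is DRHR (`log F` concave on `{F > 0}`) and
`∑_{k=i}^n 1/k ≤ ∑_{k=j}^m 1/k` with `i ≤ j`, then `X_{i:n} ≥_icx X_{j:m}`. -/
theorem stmt9 (F : ℝ → ℝ) (hF : IsCDF F)
    (i n j m : ℕ) (hi1 : 1 ≤ i) (hin : i ≤ n) (hj1 : 1 ≤ j) (hjm : j ≤ m) (hij : i ≤ j)
    (hDRHR : ConcaveOn ℝ {x : ℝ | 0 < F x} (fun x => Real.log (F x)))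
    (hcond : ∑ k ∈ Finset.Icc i n, (1:ℝ) / k ≤ ∑ k ∈ Finset.Icc j m, (1:ℝ) / k) :
    icxLE (osLaw F i n) (osLaw F j m) := by
  intro u hu huc hiu hju
  obtain ⟨hle, hlt⟩ := os_ac i n j m hi1 hin hjm hij hcond
  have hq1 := os_qf_aem F hF i n
  have hq2 := os_qf_aem F hF j m
  have hum : Measurable u := hu.measurable
  unfold osLaw at *
  rw [integrable_map_measure hum.aestronglyMeasurable hq1] at hiu
  rw [integrable_map_measure hum.aestronglyMeasurable hq2] at hju
  rw [integral_map hq1 hum.aestronglyMeasurable, integral_map hq2 hum.aestronglyMeasurable]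
  rw [os_beta_integral i n hi1 hin, os_beta_integral j m hj1 hjm]
  have k1 := os_beta_integrable i n hi1 hin _ hiu
  have k2 := os_beta_integrable j m hj1 hjm _ hju
  rw [os_sum i n hin, os_sum j m hjm] at hcond
  have hlog : ∫ t in Ioo (0:ℝ) 1, osf (j - 1) (m - j) t * Real.log t ≤
      ∫ t in Ioo (0:ℝ) 1, osf (i - 1) (n - i) t * Real.log t := by
    rw [osf_log_int, osf_log_int]
    have e1 : ((i - 1 : ℕ) : ℝ) + 1 = i := by push_cast [hi1]; ring
    have e2 : ((j - 1 : ℕ) : ℝ) + 1 = j := by push_cast [hj1]; ring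
    rw [e1, e2]
    linarith
  have ej : j - 1 = (i - 1) + (j - i) := by omega
  have em : m - j = (n - i) + ((m - j) - (n - i)) := by omega
  rw [ej, em] at hlog k2 ⊢
  refine os_core (fun y => u (qf F (Real.exp y))) (fun t => u (qf F t))
    (os_conv F hF hDRHR u hu huc) (os_mono F hF u hu) ?_ _ _ _ _ ?_ hlog k1 k2
  · intro t ht
    rw [Real.exp_log ht.1]
  · intro h
    have := hlt (by omega)
    omega
end

section
/- Let X and Y be nonnegative random variables. Then X ≥_ss Y if and only if h(X) ≥_ss h(Y) for every increasing star-shaped function h : [0,∞) → [0,∞) (i.e. every increasing h with h(0) = 0 such that x ↦ h(x)/x is increasing on (0,∞)). In particular, the composition of a star-shaped function with an increasing star-shaped function is star-shaped. -/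
open MeasureTheory Set Filter

/-- For nonnegative random variables (laws supported on `[0,∞)`):
`X ≥_ss Y` iff `h(X) ≥_ss h(Y)` for every increasing star-shaped `h`; in particular the
composition of a star-shaped function with an increasing star-shaped function is
star-shaped. -/
theorem stmt13 (μ ν : MeasureTheory.Measure ℝ)
    [MeasureTheory.IsProbabilityMeasure μ] [MeasureTheory.IsProbabilityMeasure ν]
    (hμ : μ {x : ℝ | x < 0} = 0) (hν : ν {x : ℝ | x < 0} = 0) :
    (ssLE μ ν ↔
      ∀ h : ℝ → ℝ, Measurable h → StarShaped h → MonotoneOn h (Set.Ici 0) →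
        ssLE (μ.map h) (ν.map h)) ∧
    (∀ φ h : ℝ → ℝ, StarShaped φ → StarShaped h → MonotoneOn h (Set.Ici 0) →
      StarShaped (φ ∘ h)) := by
  have hcomp : ∀ φ h : ℝ → ℝ, StarShaped φ → StarShaped h → MonotoneOn h (Set.Ici 0) →
      StarShaped (φ ∘ h) := by
    rintro φ h ⟨p0, pn, pm⟩ ⟨h0, hn, hm⟩ hmono
    refine ⟨by simp [h0, p0], fun x hx => pn _ (hn x hx), ?_⟩
    intro x hx y hy hxy
    have hx' : (0:ℝ) < x := hx
    have hy' : (0:ℝ) < y := hy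
    have hle : h x ≤ h y := hmono hx'.le hy'.le hxy
    simp only [Function.comp]
    rcases (hn x hx'.le).eq_or_lt with hz | hpos
    · rw [← hz, p0, zero_div]
      exact div_nonneg (pn _ (hn y hy'.le)) hy'.le
    · have hpos' : 0 < h y := hpos.trans_le hle
      have h1 : φ (h x) / h x ≤ φ (h y) / h y := pm hpos hpos' hle
      have h2 : h x / x ≤ h y / y := hm hx hy hxy
      calc φ (h x) / x = (φ (h x) / h x) * (h x / x) := by field_simp
        _ ≤ (φ (h y) / h y) * (h y / y) :=
          mul_le_mul h1 h2 (div_nonneg hpos.le hx'.le) (div_nonneg (pn _ hpos'.le) hpos'.le)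
        _ = φ (h y) / y := by field_simp
  refine ⟨⟨?_, ?_⟩, hcomp⟩
  · intro H h hmeas hs hmono φ hφ iμ iν
    rw [integral_map hmeas.aemeasurable iμ.aestronglyMeasurable,
      integral_map hmeas.aemeasurable iν.aestronglyMeasurable]
    exact H (φ ∘ h) (hcomp φ h hφ hs hmono) (iμ.comp_measurable hmeas) (iν.comp_measurable hmeas)
  · intro H
    have hid : StarShaped (id : ℝ → ℝ) := by
      refine ⟨rfl, fun x hx => hx, ?_⟩
      intro x hx y hy _
      have hx' : (0:ℝ) < x := hx
      have hy' : (0:ℝ) < y := hy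
      simp [div_self hx'.ne', div_self hy'.ne']
    simpa [Measure.map_id] using H id measurable_id hid (monotone_id.monotoneOn _)
end

section
/- For a, b ∈ ℝ and x ∈ (0,1), let T_{a,b}(x) = x^a (1−x)^b, and let c > 0. If a·b < 0, then the equation T_{a,b}(x) = c has exactly one solution in (0,1). If a·b > 0, then the equation T_{a,b}(x) = c has at most two solutions in (0,1). -/
open Set Filter Topology in
theorem aux_eq (a b c x : ℝ) (hc : 0 < c) (hx : x ∈ Set.Ioo (0:ℝ) 1) :
    x ^ a * (1 - x) ^ b = c ↔ a * Real.log x + b * Real.log (1 - x) = Real.log c := by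
  have h0 : 0 < x := hx.1
  have h1 : 0 < 1 - x := by linarith [hx.2]
  have hp := Real.rpow_pos_of_pos h0 a
  have hq := Real.rpow_pos_of_pos h1 b
  rw [← Real.log_rpow h0, ← Real.log_rpow h1, ← Real.log_mul hp.ne' hq.ne']
  constructor
  · intro h; rw [h]
  · intro h; exact Real.log_injOn_pos (Set.mem_Ioi.2 (mul_pos hp hq)) (Set.mem_Ioi.2 hc) h

open Set Filter Topology in
theorem aux_exists (a b L : ℝ) (ha : 0 < a) (hb : b < 0) :
    ∃ x ∈ Set.Ioo (0:ℝ) 1, a * Real.log x + b * Real.log (1 - x) = L := by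
  have hcont : ContinuousOn (fun x : ℝ => a * Real.log x + b * Real.log (1 - x)) (Ioo 0 1) := by
    apply ContinuousOn.add
    · exact continuousOn_const.mul (Real.continuousOn_log.mono fun x hx => hx.1.ne')
    · refine continuousOn_const.mul (ContinuousOn.log (by fun_prop) fun x hx => ?_)
      linarith [hx.2]
  have t1 : Tendsto (fun x : ℝ => a * Real.log x + b * Real.log (1 - x)) (𝓝[>] 0) atBot := by
    refine Tendsto.atBot_add (C := b * Real.log (1 - 0)) (Real.tendsto_log_nhdsGT_zero.const_mul_atBot ha) ?_
    have : ContinuousAt (fun x : ℝ => b * Real.log (1 - x)) 0 :=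
      continuousAt_const.mul (ContinuousAt.log (by fun_prop) (by norm_num))
    exact this.tendsto.mono_left nhdsWithin_le_nhds
  have t2 : Tendsto (fun x : ℝ => a * Real.log x + b * Real.log (1 - x)) (𝓝[<] 1) atTop := by
    refine Tendsto.add_atTop (C := a * Real.log 1) ?_ ?_
    · have : ContinuousAt (fun x : ℝ => a * Real.log x) 1 :=
        continuousAt_const.mul (ContinuousAt.log (by fun_prop) (by norm_num))
      exact this.tendsto.mono_left nhdsWithin_le_nhds
    · refine Tendsto.const_mul_atBot_of_neg hb (Real.tendsto_log_nhdsGT_zero.comp ?_)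
      refine tendsto_nhdsWithin_iff.2 ⟨?_, ?_⟩
      · have : ContinuousAt (fun x : ℝ => 1 - x) 1 := by fun_prop
        have h := this.tendsto.mono_left (nhdsWithin_le_nhds (s := Iio 1))
        simpa using h
      · filter_upwards [self_mem_nhdsWithin] with x hx
        simpa using hx
  have l1 : (𝓝[>] (0:ℝ)) ≤ 𝓟 (Ioo 0 1) := le_principal_iff.2 (Ioo_mem_nhdsGT one_pos)
  have l2 : (𝓝[<] (1:ℝ)) ≤ 𝓟 (Ioo 0 1) := le_principal_iff.2 (Ioo_mem_nhdsLT one_pos)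
  obtain ⟨x, hx, h⟩ := isPreconnected_Ioo.intermediate_value_Iii l1 l2 hcont t1 t2 (mem_univ L)
  exact ⟨x, hx, h⟩

theorem aux_lt (a b x y : ℝ) (ha : 0 < a) (hb : b < 0) (hx : x ∈ Set.Ioo (0:ℝ) 1)
    (hy : y ∈ Set.Ioo (0:ℝ) 1) (h : x < y) :
    a * Real.log x + b * Real.log (1 - x) < a * Real.log y + b * Real.log (1 - y) := by
  have h1 := Real.log_lt_log hx.1 h
  have h2 : Real.log (1 - y) < Real.log (1 - x) :=
    Real.log_lt_log (by linarith [hy.2]) (by linarith)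
  have := mul_lt_mul_of_pos_left h1 ha
  have := mul_lt_mul_of_neg_left h2 hb
  linarith

theorem aux_unique (a b c : ℝ) (hc : 0 < c) (ha : 0 < a) (hb : b < 0) :
    ∃! x : ℝ, x ∈ Set.Ioo (0:ℝ) 1 ∧ x ^ a * (1 - x) ^ b = c := by
  obtain ⟨x, hx, h⟩ := aux_exists a b (Real.log c) ha hb
  refine ⟨x, ⟨hx, (aux_eq a b c x hc hx).2 h⟩, ?_⟩
  rintro y ⟨hy, h'⟩
  rw [aux_eq a b c y hc hy] at h'
  rcases lt_trichotomy y x with hl | hl | hl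
  · linarith [aux_lt a b y x ha hb hy hx hl]
  · exact hl
  · linarith [aux_lt a b x y ha hb hx hy hl]

theorem aux_conc (a b x y z L : ℝ) (ha : 0 < a) (hb : 0 < b) (hx : x ∈ Set.Ioo (0:ℝ) 1)
    (hz : z ∈ Set.Ioo (0:ℝ) 1) (hxy : x < y) (hyz : y < z)
    (ex : a * Real.log x + b * Real.log (1 - x) = L)
    (ey : a * Real.log y + b * Real.log (1 - y) = L)
    (ez : a * Real.log z + b * Real.log (1 - z) = L) : False := by
  have hd : 0 < z - x := by linarith
  obtain ⟨s, t, hs, ht, hst, rfl⟩ : ∃ s t : ℝ, 0 < s ∧ 0 < t ∧ s + t = 1 ∧ s * x + t * z = y :=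
    ⟨(z - y) / (z - x), (y - x) / (z - x), div_pos (by linarith) hd, div_pos (by linarith) hd,
      by field_simp; ring, by field_simp; ring⟩
  have hne : x ≠ z := by linarith
  have h1 := strictConcaveOn_log_Ioi.2 (Set.mem_Ioi.2 hx.1) (Set.mem_Ioi.2 hz.1) hne hs ht hst
  have h2 := strictConcaveOn_log_Ioi.2 (x := 1 - x) (y := 1 - z)
    (Set.mem_Ioi.2 (by linarith [hx.2])) (Set.mem_Ioi.2 (by linarith [hz.2]))
    (fun h => hne (by linarith)) hs ht hst
  simp only [smul_eq_mul] at h1 h2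
  rw [show s * (1 - x) + t * (1 - z) = 1 - (s * x + t * z) by linear_combination hst] at h2
  have e1 := mul_lt_mul_of_pos_left h1 ha
  have e2 := mul_lt_mul_of_pos_left h2 hb
  have : s * (a * Real.log x + b * Real.log (1 - x)) + t * (a * Real.log z + b * Real.log (1 - z)) = L := by
    rw [ex, ez, ← add_mul, hst, one_mul]
  linarith

theorem aux_two (a b x y z L : ℝ) (hab : 0 < a * b) (hx : x ∈ Set.Ioo (0:ℝ) 1)
    (hz : z ∈ Set.Ioo (0:ℝ) 1) (hxy : x < y) (hyz : y < z)
    (ex : a * Real.log x + b * Real.log (1 - x) = L)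
    (ey : a * Real.log y + b * Real.log (1 - y) = L)
    (ez : a * Real.log z + b * Real.log (1 - z) = L) : False := by
  rcases pos_and_pos_or_neg_and_neg_of_mul_pos hab with ⟨ha, hb⟩ | ⟨ha, hb⟩
  · exact aux_conc a b x y z L ha hb hx hz hxy hyz ex ey ez
  · exact aux_conc (-a) (-b) x y z (-L) (by linarith) (by linarith) hx hz hxy hyz
      (by linarith) (by linarith) (by linarith)

/-- For `T_{a,b}(x) = x^a (1-x)^b` on `(0,1)` and `c > 0`: if `a·b < 0`
the equation `T_{a,b}(x) = c` has exactly one solution in `(0,1)`; if `a·b > 0` it has at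
most two solutions in `(0,1)`. -/
theorem stmt14 (a b c : ℝ) (hc : 0 < c) :
    (a * b < 0 → ∃! x : ℝ, x ∈ Set.Ioo (0:ℝ) 1 ∧ x ^ a * (1 - x) ^ b = c) ∧
    (0 < a * b →
      ∀ x ∈ {x : ℝ | x ∈ Set.Ioo (0:ℝ) 1 ∧ x ^ a * (1 - x) ^ b = c},
      ∀ y ∈ {x : ℝ | x ∈ Set.Ioo (0:ℝ) 1 ∧ x ^ a * (1 - x) ^ b = c},
      ∀ z ∈ {x : ℝ | x ∈ Set.Ioo (0:ℝ) 1 ∧ x ^ a * (1 - x) ^ b = c},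
        x = y ∨ x = z ∨ y = z) := by
  constructor
  · intro hab
    rcases mul_neg_iff.1 hab with ⟨ha, hb⟩ | ⟨ha, hb⟩
    · exact aux_unique a b c hc ha hb
    · obtain ⟨x, ⟨hx, h⟩, hu⟩ := aux_unique b a c hc hb ha
      refine ⟨1 - x, ⟨⟨by linarith [hx.2], by linarith [hx.1]⟩, ?_⟩, ?_⟩
      · rw [sub_sub_cancel, mul_comm]; exact h
      · rintro y ⟨hy, h'⟩
        have := hu (1 - y) ⟨⟨by linarith [hy.2], by linarith [hy.1]⟩, by
          rw [sub_sub_cancel, mul_comm]; exact h'⟩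
        linarith
  · rintro hab x ⟨hx, ex⟩ y ⟨hy, ey⟩ z ⟨hz, ez⟩
    rw [aux_eq a b c _ hc hx] at ex
    rw [aux_eq a b c _ hc hy] at ey
    rw [aux_eq a b c _ hc hz] at ez
    by_contra! hn
    obtain ⟨n1, n2, n3⟩ := hn
    rcases lt_or_gt_of_ne n1 with h1 | h1 <;> rcases lt_or_gt_of_ne n2 with h2 | h2 <;>
      rcases lt_or_gt_of_ne n3 with h3 | h3
    · exact aux_two a b x y z _ hab hx hz h1 h3 ex ey ez
    · exact aux_two a b x z y _ hab hx hy h2 h3 ex ez ey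
    · linarith
    · exact aux_two a b z x y _ hab hz hy h2 h1 ez ex ey
    · exact aux_two a b y x z _ hab hy hz h1 h2 ey ex ez
    · linarith
    · exact aux_two a b y z x _ hab hy hx h3 h2 ey ez ex
    · exact aux_two a b z y x _ hab hz hx h3 h1 ez ey ex
end
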